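/- Let n ≥ 2 and let G₁,…,G_n be nontrivial finitely generated groups with finite generating sets S₁,…,S_n, and assume the free product is not virtually ℤ, i.e., it is not the case that n = 2 and both G₁ and G₂ have exactly two elements. Then the critical probability of the Cayley graph of G₁*…*G_n with respect to S₁ ⊔ … ⊔ S_n is strictly smaller than min_{1≤i≤n} p_c(Gᵢ), where p_c(Gᵢ) is the critical probability of the Cayley graph of (Gᵢ,Sᵢ). -/

import Mathlib

open MeasureTheory ENNReal

namespace Perc

/-- Percolation configurations on the edge set `E`: each edge is `true` (open) or
`false` (closed). -/
abbrev Config (E : Type*) := E → Bool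

/-- `μ` is the Bernoulli product measure `P_p` with parameter `p` on `{0,1}^E`: the measure
of every finite cylinder event is the corresponding product.  (This determines `μ` uniquely
on the product σ-algebra, since cylinders form a π-system generating it.) -/
def IsBernoulli {E : Type*} (p : ℝ) (μ : Measure (Config E)) : Prop :=
  ∀ (F : Finset E) (σ : E → Bool),
    μ {ω | ∀ e ∈ F, ω e = σ e} =
      ∏ e ∈ F, ENNReal.ofReal (if σ e then p else 1 - p)

variable {G ι : Type*} [Group G]

/-- In the Cayley graph of `G` with edge set `G × ι`, where the edge `(a, i)` joins `a` and
`a * f i` (the function `f : ι → G` lists the generators, with multiplicity), this says that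
vertices `a` and `b` are joined by some open edge of the configuration `ω`. -/
def Step (f : ι → G) (ω : Config (G × ι)) (a b : G) : Prop :=
  ∃ i : ι, (ω (a, i) = true ∧ b = a * f i) ∨ (ω (b, i) = true ∧ a = b * f i)

/-- `x` and `y` are connected by a path of open edges (`x ↔ y`). -/
def Conn (f : ι → G) (ω : Config (G × ι)) (x y : G) : Prop :=
  Relation.ReflTransGen (Step f ω) x y

/-- The open cluster `C` of the identity. -/
def cluster (f : ι → G) (ω : Config (G × ι)) : Set G :=
  {x | Conn f ω 1 x}

/-- The percolation function `θ`: the probability that the cluster of the identity is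
infinite. -/
noncomputable def theta (f : ι → G) (μ : Measure (Config (G × ι))) : ℝ :=
  (μ {ω | (cluster f ω).Infinite}).toReal

/-- The expected cluster size `χ = E(|C|) ∈ [0,∞]` (where `|C| ∈ ℕ∞` is coerced
to `ℝ≥0∞`). -/
noncomputable def chi (f : ι → G) (μ : Measure (Config (G × ι))) : ℝ≥0∞ :=
  ∫⁻ ω, ((cluster f ω).encard : ℝ≥0∞) ∂μ

/-- The critical probability `p_c = inf {p ∈ [0,1] | θ(p) > 0}`, with the convention
`p_c = 1` if `θ` vanishes on `[0,1]`; here `μ p` is the percolation measure at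
parameter `p`. -/
noncomputable def pc (f : ι → G) (μ : ℝ → Measure (Config (G × ι))) : ℝ :=
  sInf ({p | p ∈ Set.Icc (0 : ℝ) 1 ∧ 0 < theta f (μ p)} ∪ {1})

/-- The word metric on `G` with respect to the generators `f i`: the length of a shortest
word in the generators and their inverses taking `x` to `y`.  (When the generators generate
`G`, this is the graph distance in the Cayley graph.) -/
noncomputable def wdist (f : ι → G) (x y : G) : ℕ :=
  sInf {n : ℕ | ∃ l : List G, l.length = n ∧
    (∀ g ∈ l, (∃ i, f i = g) ∨ (∃ i, (f i)⁻¹ = g)) ∧ x * l.prod = y}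

/-- Schonmann's critical point
`p_exp = sup {p ∈ [0,1] | ∃ c > 0, γ > 0, ∀ x y, P_p(x ↔ y) ≤ c·exp(-γ·dist(x,y))}`. -/
noncomputable def pexp (f : ι → G) (μ : ℝ → Measure (Config (G × ι))) : ℝ :=
  sSup {p | p ∈ Set.Icc (0 : ℝ) 1 ∧ ∃ c > 0, ∃ γ > 0, ∀ x y : G,
    (μ p {ω | Conn f ω x y}).toReal ≤ c * Real.exp (-γ * (wdist f x y : ℝ))}

/-- The walk-through function `g(p,t) = 1 - ∑_{n≥1} (1-t)^{n-1} P_p(|C| = n)` of a Cayley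
graph; here `μ` is the percolation measure at parameter `p`. -/
noncomputable def wt (f : ι → G) (μ : Measure (Config (G × ι))) (t : ℝ) : ℝ :=
  1 - ∑' n : ℕ, (1 - t) ^ n * (μ {ω | (cluster f ω).encard = ((n + 1 : ℕ) : ℕ∞)}).toReal

/-- The ball of radius `j`: all products of at most `j` elements of `S ∪ S⁻¹`. -/
def ball (S : Set G) (j : ℕ) : Set G :=
  {g | ∃ l : List G, l.length ≤ j ∧ (∀ x ∈ l, x ∈ S ∨ x⁻¹ ∈ S) ∧ l.prod = g}

/-- The Cheeger constant `h = inf_K |∂K| / |K|`, the infimum over nonempty finite vertex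
sets `K` of the number of edges `(a, i)` (joining `a` and `a * f i`) with exactly one
endpoint in `K`, divided by `|K|`. -/
noncomputable def cheeger (f : ι → G) : ℝ :=
  ⨅ K : {K : Finset G // K.Nonempty},
    (Nat.card {e : G × ι // Xor' (e.1 ∈ K.1) (e.1 * f e.2 ∈ K.1)} : ℝ) / (K.1.card : ℝ)

/-- The open cluster of the identity in the subgraph induced on the vertex set `V`: only
open edges with both endpoints in `V` may be used. -/
def clusterIn (f : ι → G) (V : Set G) (ω : Config (G × ι)) : Set G :=
  {x | Relation.ReflTransGen (fun a b => Step f ω a b ∧ a ∈ V ∧ b ∈ V) 1 x}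

/-- The generators of `G` given by a generating set `S` (one edge orbit per element
of `S`). -/
def setGens (S : Set G) : S → G := Subtype.val

/-- The generators of the free product `G₁ * G₂` given by the disjoint union `S₁ ⊔ S₂` of
generating sets, embedded via the canonical monomorphisms. -/
def coprodGens {G₁ G₂ : Type*} [Group G₁] [Group G₂] (S₁ : Set G₁) (S₂ : Set G₂) :
    S₁ ⊕ S₂ → Monoid.Coprod G₁ G₂ :=
  Sum.elim (fun s => Monoid.Coprod.inl (s : G₁)) (fun s => Monoid.Coprod.inr (s : G₂))

/-- The generators of the free product `G₁ * ⋯ * G_n` given by the disjoint union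
`S₁ ⊔ ⋯ ⊔ S_n` of generating sets, embedded via the canonical monomorphisms. -/
def coprodIGens {n : ℕ} {G : Fin n → Type*} [∀ i, Group (G i)] (S : ∀ i, Set (G i)) :
    (Σ i, S i) → Monoid.CoprodI G :=
  fun x => Monoid.CoprodI.of (x.2 : G x.1)

/-- The image of a list of syllables in the free product `G₁ * G₂`. -/
def sylProd {G₁ G₂ : Type*} [Group G₁] [Group G₂] (l : List (G₁ ⊕ G₂)) :
    Monoid.Coprod G₁ G₂ :=
  (l.map (Sum.elim (fun g => Monoid.Coprod.inl g) (fun h => Monoid.Coprod.inr h))).prod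

/-- The set `P₁` of nontrivial elements of `G₁ * G₂` whose normal form begins with a
nontrivial syllable of `G₁`: elements represented by a nonempty alternating product of
nontrivial syllables, the first syllable lying in `G₁`.  (Such a representation is the
normal form, which is unique.) -/
def beginsLeft {G₁ G₂ : Type*} [Group G₁] [Group G₂] (x : Monoid.Coprod G₁ G₂) : Prop :=
  ∃ l : List (G₁ ⊕ G₂), l ≠ [] ∧ (∀ a ∈ l, a ≠ Sum.inl 1 ∧ a ≠ Sum.inr 1) ∧
    l.Chain' (fun a b => a.isLeft ≠ b.isLeft) ∧
    (∃ g : G₁, l.head? = some (Sum.inl g)) ∧ sylProd l = x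

/-- The set `P₂` of nontrivial elements of `G₁ * G₂` whose normal form begins with a
nontrivial syllable of `G₂`. -/
def beginsRight {G₁ G₂ : Type*} [Group G₁] [Group G₂] (x : Monoid.Coprod G₁ G₂) : Prop :=
  ∃ l : List (G₁ ⊕ G₂), l ≠ [] ∧ (∀ a ∈ l, a ≠ Sum.inl 1 ∧ a ≠ Sum.inr 1) ∧
    l.Chain' (fun a b => a.isLeft ≠ b.isLeft) ∧
    (∃ h : G₂, l.head? = some (Sum.inr h)) ∧ sylProd l = x

end Perc

open Perc

namespace Perc

section Bernoulli

variable {E E' : Type*} {p : ℝ} {μ : Measure (Config E)}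

/-- The law of a single edge: `true` with probability `p`. -/
noncomputable def coin (p : ℝ) : Measure Bool :=
  ENNReal.ofReal p • Measure.dirac true + ENNReal.ofReal (1 - p) • Measure.dirac false

lemma coin_singleton (p : ℝ) (b : Bool) :
    coin p {b} = ENNReal.ofReal (if b then p else 1 - p) := by
  cases b <;> simp [coin]

lemma isProbabilityMeasure_coin (hp : p ∈ Set.Icc (0 : ℝ) 1) : IsProbabilityMeasure (coin p) := by
  refine ⟨?_⟩
  simp only [coin, Measure.coe_add, Measure.coe_smul, Pi.add_apply, Pi.smul_apply, measure_univ,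
    smul_eq_mul, mul_one]
  rw [← ENNReal.ofReal_add hp.1 (by linarith [hp.2])]
  simp

lemma IsBernoulli.eq_infinitePi (hμ : IsBernoulli p μ) (hp : p ∈ Set.Icc (0 : ℝ) 1) :
    μ = Measure.infinitePi (fun _ : E => coin p) := by
  have := isProbabilityMeasure_coin hp
  refine IsProjectiveLimit.unique (P := fun I : Finset E => Measure.pi fun _ : I => coin p)
    (fun I => ?_) (Measure.isProjectiveLimit_infinitePi _)
  refine Measure.ext_of_singleton fun σ => ?_
  classical
  rw [Measure.map_apply (by fun_prop) (measurableSet_singleton _)]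
  have h := hμ I (fun e => if h : e ∈ I then σ ⟨e, h⟩ else false)
  have h1 : I.restrict ⁻¹' ({σ} : Set (I → Bool)) =
      {ω : Config E | ∀ e ∈ I, ω e = if h : e ∈ I then σ ⟨e, h⟩ else false} := by
    ext ω
    simp only [Set.mem_preimage, Set.mem_singleton_iff, funext_iff, Subtype.forall,
      Finset.restrict, Set.mem_ofPred_eq]
    refine forall₂_congr fun e he => ?_
    rw [dif_pos he]
  rw [h1, h, Measure.pi_singleton, ← Finset.prod_attach, Finset.univ_eq_attach]
  refine Finset.prod_congr rfl fun e _ => ?_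
  rw [coin_singleton, dif_pos e.2]

lemma IsBernoulli.isProbabilityMeasure (hμ : IsBernoulli p μ) : IsProbabilityMeasure μ := by
  refine ⟨?_⟩
  simpa using hμ ∅ (fun _ => true)

/-- Reindexing along an injection preserves Bernoulli measures. -/
lemma IsBernoulli.measure_preimage_comp {ν : Measure (Config E')} (hμ : IsBernoulli p μ)
    (hν : IsBernoulli p ν) (hp : p ∈ Set.Icc (0 : ℝ) 1) {φ : E' → E} (hφ : φ.Injective)
    {s : Set (Config E')} (hs : MeasurableSet s) :
    μ.real {ω | ω ∘ φ ∈ s} = ν.real s := by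
  have := isProbabilityMeasure_coin hp
  have h := Measure.map_infinitePi_infinitePi_of_inj (P := fun _ : E => coin p) hφ
  rw [← hμ.eq_infinitePi hp, ← hν.eq_infinitePi hp] at h
  rw [measureReal_def, measureReal_def, ← h, Measure.map_apply (by fun_prop) hs]
  rfl

/-- The configuration which agrees with `ω` on `X` and has all other edges closed. -/
noncomputable def restr (X : Set E) (ω : Config E) : Config E := by
  classical exact fun e => if e ∈ X then ω e else false

lemma restr_eq_true {X : Set E} {ω : Config E} {e : E} :
    restr X ω e = true ↔ e ∈ X ∧ ω e = true := by
  classical simp [restr]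

lemma restr_restr (X Y : Set E) (ω : Config E) : restr X (restr Y ω) = restr (X ∩ Y) ω := by
  funext e
  rw [Bool.eq_iff_iff]
  simp only [restr_eq_true, Set.mem_inter_iff, and_assoc]

lemma restr_comp {X : Set E} {ω : Config E} {φ : E' → E} :
    restr X ω ∘ φ = restr (φ ⁻¹' X) (ω ∘ φ) := by
  classical
  funext e
  simp [restr]

/-- `s` is determined by the states of the edges in `X`. -/
def DeterminedBy (s : Set (Config E)) (X : Set E) : Prop :=
  ∀ ω, restr X ω ∈ s ↔ ω ∈ s

lemma DeterminedBy.mono {s : Set (Config E)} {X Y : Set E} (h : DeterminedBy s X) (hXY : X ⊆ Y) :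
    DeterminedBy s Y := fun ω => by
  rw [← h (restr Y ω), restr_restr, Set.inter_eq_left.2 hXY, h]

lemma determinedBy_setOf_restr (P : Config E → Prop) (X : Set E) :
    DeterminedBy {ω | P (restr X ω)} X := fun ω => by
  simp [restr_restr]

lemma DeterminedBy.comp {s : Set (Config E')} {X : Set E'} (h : DeterminedBy s X)
    {φ : E' → E} {Y : Set E} (hY : φ ⁻¹' Y = X) : DeterminedBy {ω | ω ∘ φ ∈ s} Y := fun ω => by
  simp only [Set.mem_ofPred_eq, restr_comp, hY]
  exact h _

lemma measurable_restr (X : Set E) : Measurable (restr X) := by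
  classical
  refine measurable_pi_lambda _ fun e => ?_
  by_cases he : e ∈ X
  · simpa [restr, he] using measurable_pi_apply e
  · simp [restr, he]

lemma DeterminedBy.measurableSet {s : Set (Config E)} {X : Set E} (h : DeterminedBy s X)
    (hs : MeasurableSet s) :
    MeasurableSet[⨆ e ∈ X, MeasurableSpace.comap (fun ω : Config E => ω e) ⊤] s := by
  classical
  have hm : Measurable[⨆ e ∈ X, MeasurableSpace.comap (fun ω : Config E => ω e) ⊤] (restr X) := by
    refine @measurable_pi_lambda _ _ _ (_) _ _ fun e => ?_
    by_cases he : e ∈ X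
    · have h1 : (fun ω : Config E => restr X ω e) = fun ω => ω e := by
        funext ω; simp [restr, he]
      rw [h1]
      exact (Measurable.of_comap_le le_rfl).mono
        (le_iSup₂_of_le (f := fun e (_ : e ∈ X) =>
          MeasurableSpace.comap (fun ω : Config E => ω e) ⊤) e he le_rfl) le_rfl
    · have h1 : (fun ω : Config E => restr X ω e) = fun _ => false := by
        funext ω; simp [restr, he]
      rw [h1]
      exact @measurable_const _ _ _ (_) _
  have h2 : s = restr X ⁻¹' s := by
    ext ω; exact (h ω).symm
  rw [h2]
  exact hm hs

/-- Events determined by disjoint sets of edges are independent. -/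
lemma IsBernoulli.real_inter (hμ : IsBernoulli p μ) (hp : p ∈ Set.Icc (0 : ℝ) 1)
    {s t : Set (Config E)} {X Y : Set E} (hs : MeasurableSet s) (ht : MeasurableSet t)
    (hsX : DeterminedBy s X) (htY : DeterminedBy t Y) (hXY : Disjoint X Y) :
    μ.real (s ∩ t) = μ.real s * μ.real t := by
  have := isProbabilityMeasure_coin hp
  have hind := ProbabilityTheory.iIndepFun_infinitePi (P := fun _ : E => coin p)
    (X := fun _ b => b) (fun _ => measurable_id)
  rw [← hμ.eq_infinitePi hp] at hind
  have h := ProbabilityTheory.indep_iSup_of_disjoint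
    (fun e => (measurable_pi_apply e).comap_le) hind hXY
  have h' := (ProbabilityTheory.Indep_iff _ _ _).1 h s t (hsX.measurableSet hs)
    (htY.measurableSet ht)
  simp only [measureReal_def, h', ENNReal.toReal_mul]

/-- The probability of an event determined by finitely many edges is continuous in `p`. -/
lemma exists_continuous_real_eq {s : Set (Config E)} {X : Set E} (hX : X.Finite)
    (hs : DeterminedBy s X) :
    ∃ h : ℝ → ℝ, Continuous h ∧ ∀ p ∈ Set.Icc (0 : ℝ) 1, ∀ μ : Measure (Config E),
      IsBernoulli p μ → μ.real s = h p := by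
  classical
  set F := hX.toFinset
  let c : Finset E → Config E := fun A e => decide (e ∈ A)
  let T := F.powerset.filter fun A => c A ∈ s
  refine ⟨fun p => ∑ A ∈ T, ∏ e ∈ F, if c A e then p else 1 - p, ?_, ?_⟩
  · refine continuous_finsetSum _ fun A _ => continuous_finsetProd _ fun e _ => ?_
    split_ifs <;> fun_prop
  · intro p hp μ hμ
    have := hμ.isProbabilityMeasure
    have hU : s = ⋃ A ∈ T, {ω | ∀ e ∈ F, ω e = c A e} := by
      ext ω
      simp only [Set.mem_iUnion, Set.mem_ofPred_eq, exists_prop]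
      have key : ∀ A, A ⊆ F → (∀ e ∈ F, ω e = c A e) → restr X ω = c A := by
        intro A hA h
        funext e
        by_cases he : e ∈ X
        · simpa [restr, he] using h e (by simpa [F] using he)
        · have : e ∉ A := fun h => he (by simpa [F] using hA h)
          simp [restr, he, c, this]
      constructor
      · intro h
        have h1 : ∀ e ∈ F, ω e = c (F.filter fun e => ω e = true) e := by
          intro e he
          simp [c, he]
        refine ⟨F.filter fun e => ω e = true, ?_, h1⟩
        simp only [T, Finset.mem_filter, Finset.mem_powerset, Finset.filter_subset, true_and]
        rw [← key _ (Finset.filter_subset _ _) h1]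
        exact (hs ω).2 h
      · rintro ⟨A, hA, h⟩
        simp only [T, Finset.mem_filter, Finset.mem_powerset] at hA
        rw [← hs ω, key A hA.1 h]
        exact hA.2
    conv_lhs => rw [hU]
    rw [measureReal_biUnion_finset]
    · refine Finset.sum_congr rfl fun A _ => ?_
      rw [measureReal_def, hμ, ENNReal.toReal_prod]
      refine Finset.prod_congr rfl fun e _ => ENNReal.toReal_ofReal ?_
      split_ifs
      · exact hp.1
      · linarith [hp.2]
    · intro A hA B hB hAB
      refine Set.disjoint_left.2 fun ω h1 h2 => hAB ?_
      simp only [T, Finset.mem_coe, Finset.mem_filter, Finset.mem_powerset] at hA hB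
      ext e
      by_cases he : e ∈ F
      · have := (h1 e he).symm.trans (h2 e he)
        simpa [c] using this
      · exact ⟨fun h => (he (hA.1 h)).elim, fun h => (he (hB.1 h)).elim⟩
    · intro A _
      have : {ω : Config E | ∀ e ∈ F, ω e = c A e} = ⋂ e ∈ F, (fun ω => ω e) ⁻¹' {c A e} := by
        ext; simp
      rw [this]
      exact Finset.measurableSet_biInter _ fun e _ =>
        measurable_pi_apply e (measurableSet_singleton _)

end Bernoulli

section Connectivity

variable {G H ι κ : Type*} [Group G] [Group H] {f : ι → G} {f' : κ → H}

lemma Step.symm {ω : Config (G × ι)} {a b : G} (h : Step f ω a b) : Step f ω b a := by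
  obtain ⟨i, h | h⟩ := h
  exacts [⟨i, .inr h⟩, ⟨i, .inl h⟩]

lemma Step.of_open {ω : Config (G × ι)} {a : G} {i : ι} (h : ω (a, i) = true) :
    Step f ω a (a * f i) := ⟨i, .inl ⟨h, rfl⟩⟩

/-- A map of vertices sending open edges which are not loops to open edges preserves
connections. -/
lemma Conn.map {ω : Config (G × ι)} {ω' : Config (H × κ)} (ψ : H → G)
    (hψ : ∀ a k, ω' (a, k) = true → a ≠ a * f' k → Step f ω (ψ a) (ψ (a * f' k)))
    {a b : H} (h : Conn f' ω' a b) : Conn f ω (ψ a) (ψ b) := by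
  refine Relation.ReflTransGen.lift' ψ (fun a b hab => ?_) _ _ h
  by_cases hne : a = b
  · rw [hne]
  obtain ⟨k, ⟨hk, rfl⟩ | ⟨hk, rfl⟩⟩ := hab
  · exact .single (hψ _ _ hk hne)
  · exact .single (hψ _ _ hk (Ne.symm hne)).symm

lemma Conn.mono {ω ω' : Config (G × ι)} (hω : ∀ e, ω' e = true → ω e = true) {a b : G}
    (h : Conn f ω' a b) : Conn f ω a b :=
  Conn.map id (fun _ _ hk _ => Step.of_open (hω _ hk)) h

lemma Conn.of_restr {X : Set (G × ι)} {ω : Config (G × ι)} {a b : G}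
    (h : Conn f (restr X ω) a b) : Conn f ω a b :=
  h.mono fun _ he => (restr_eq_true.1 he).2

lemma Conn.restr_mono {X Y : Set (G × ι)} (hXY : X ⊆ Y) {ω : Config (G × ι)} {a b : G}
    (h : Conn f (restr X ω) a b) : Conn f (restr Y ω) a b :=
  h.mono fun _ he => restr_eq_true.2 ⟨hXY (restr_eq_true.1 he).1, (restr_eq_true.1 he).2⟩

/-- Left translation of edges. -/
def shift (ι : Type*) (x : G) (e : G × ι) : G × ι := (x * e.1, e.2)

lemma shift_injective (x : G) : (shift ι x).Injective := by
  rintro ⟨a, i⟩ ⟨b, j⟩ h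
  simpa [shift] using h

lemma Conn.of_shift {ω : Config (G × ι)} (x : G) {a b : G} (h : Conn f (ω ∘ shift ι x) a b) :
    Conn f ω (x * a) (x * b) :=
  h.map (x * ·) fun a k hk _ => by
    have : ω (x * a, k) = true := hk
    simpa [mul_assoc] using Step.of_open (f := f) this

lemma conn_shift {ω : Config (G × ι)} (x : G) {a b : G} :
    Conn f (ω ∘ shift ι x) a b ↔ Conn f ω (x * a) (x * b) := by
  refine ⟨Conn.of_shift x, fun h => ?_⟩
  have h1 : ω = (ω ∘ shift ι x) ∘ shift ι x⁻¹ := by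
    funext e
    simp [shift]
  rw [h1] at h
  simpa using h.of_shift x⁻¹

lemma measurableSet_reflTransGen {Ω V : Type*} [MeasurableSpace Ω] [Countable V]
    {R : Ω → V → V → Prop} (hR : ∀ a b, MeasurableSet {ω | R ω a b}) (a b : V) :
    MeasurableSet {ω | Relation.ReflTransGen (R ω) a b} := by
  let P : ℕ → Ω → V → Prop :=
    fun n => n.rec (fun _ c => a = c) (fun _ Q ω c => ∃ b, Q ω b ∧ R ω b c)
  have hP : ∀ n c, MeasurableSet {ω | P n ω c} := by
    intro n
    induction n with
    | zero => exact fun c => MeasurableSet.const (a = c)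
    | succ n ih =>
      intro c
      have : {ω | P (n + 1) ω c} = ⋃ b, {ω | P n ω b} ∩ {ω | R ω b c} := by
        ext ω; simp [P]
      rw [this]
      exact MeasurableSet.iUnion fun b => (ih b).inter (hR b c)
  have : {ω | Relation.ReflTransGen (R ω) a b} = ⋃ n, {ω | P n ω b} := by
    ext ω
    simp only [Set.mem_iUnion, Set.mem_ofPred_eq]
    constructor
    · intro h
      induction h with
      | refl => exact ⟨0, rfl⟩
      | tail _ hs ih =>
        obtain ⟨n, hn⟩ := ih
        exact ⟨n + 1, _, hn, hs⟩
    · rintro ⟨n, hn⟩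
      induction n generalizing b with
      | zero => cases hn; exact .refl
      | succ n ih =>
        obtain ⟨c, hc, hs⟩ := hn
        exact (ih c hc).tail hs
  rw [this]
  exact MeasurableSet.iUnion fun n => hP n b

variable [Countable G] [Countable ι]

lemma measurableSet_conn (f : ι → G) (a b : G) :
    MeasurableSet {ω : Config (G × ι) | Conn f ω a b} := by
  refine measurableSet_reflTransGen (R := fun ω => Step f ω) (fun a b => ?_) a b
  have : {ω : Config (G × ι) | Step f ω a b} =
      ⋃ i, ({ω | ω (a, i) = true} ∩ {_ω | b = a * f i}) ∪
        ({ω | ω (b, i) = true} ∩ {_ω | a = b * f i}) := by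
    ext ω
    simp [Step]
  rw [this]
  have hm : ∀ e : G × ι, MeasurableSet {ω : Config (G × ι) | ω e = true} := fun e =>
    measurableSet_eq_fun (measurable_pi_apply e) measurable_const
  exact MeasurableSet.iUnion fun i =>
    ((hm _).inter (MeasurableSet.const _)).union ((hm _).inter (MeasurableSet.const _))

lemma measurableSet_conn_restr (f : ι → G) (X : Set (G × ι)) (a b : G) :
    MeasurableSet {ω : Config (G × ι) | Conn f (restr X ω) a b} :=
  measurable_restr X (measurableSet_conn f a b)

end Connectivity

section Branching

/-- A Bonferroni-type lower bound for the probability of a union. -/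
lemma sum_sub_le_measureReal_biUnion {Ω κ : Type*} [MeasurableSpace Ω] (μ : Measure Ω)
    [IsFiniteMeasure μ] {A : κ → Set Ω} (hA : ∀ k, MeasurableSet (A k)) {ε : ℝ} (hε : 0 ≤ ε)
    (hpair : ∀ k l, k ≠ l → μ.real (A k ∩ A l) ≤ ε) (s : Finset κ) :
    ∑ k ∈ s, μ.real (A k) - (s.card : ℝ) ^ 2 * ε ≤ μ.real (⋃ k ∈ s, A k) := by
  classical
  induction s using Finset.induction_on with
  | empty => simp
  | insert a s ha ih =>
    have hm : MeasurableSet (⋃ k ∈ s, A k) := s.measurableSet_biUnion fun k _ => hA k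
    have h1 := measureReal_union_add_inter (μ := μ) (s := A a) hm (measure_ne_top _ _)
      (measure_ne_top _ _)
    have h2 : μ.real (A a ∩ ⋃ k ∈ s, A k) ≤ s.card * ε := by
      rw [Set.inter_iUnion₂]
      refine (measureReal_biUnion_finset_le s _).trans ?_
      rw [← nsmul_eq_mul]
      exact Finset.sum_le_card_nsmul _ _ _ fun k hk => hpair a k fun h => ha (h ▸ hk)
    rw [Finset.set_biUnion_insert, Finset.sum_insert ha, Finset.card_insert_of_notMem ha]
    push_cast
    nlinarith [mul_nonneg (Nat.cast_nonneg (α := ℝ) s.card) hε]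

variable {G ι κ : Type*} [Group G] {f : ι → G}

lemma list_eq_of_prod_eq {w : κ → G} {V : Set G} (h1 : 1 ∈ V) (hV : ∀ k, ∀ v ∈ V, w k * v ∈ V)
    (hdisj : ∀ k l, ∀ v ∈ V, ∀ v' ∈ V, w k * v = w l * v' → k = l)
    (hone : ∀ k, ∀ v ∈ V, w k * v ≠ 1) {l l' : List κ}
    (h : (l.map w).prod = (l'.map w).prod) : l = l' := by
  have hmem : ∀ l : List κ, (l.map w).prod ∈ V := by
    intro l
    induction l with
    | nil => simpa
    | cons k l ih => simpa using hV k _ ih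
  induction l generalizing l' with
  | nil =>
    cases l' with
    | nil => rfl
    | cons k l' => exact (hone k _ (hmem l') (by simpa using h.symm)).elim
  | cons k l ih =>
    cases l' with
    | nil => exact (hone k _ (hmem l) (by simpa using h)).elim
    | cons k' l' =>
      simp only [List.map_cons, List.prod_cons] at h
      obtain rfl := hdisj _ _ _ (hmem l) _ (hmem l') h
      rw [ih (mul_left_cancel h)]

/-- The edges which are not loops and have both endpoints in `V`. -/
def edgesIn (f : ι → G) (V : Set G) : Set (G × ι) :=
  {e | e.1 ∈ V ∧ e.1 * f e.2 ∈ V ∧ e.1 ≠ e.1 * f e.2}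

/-- The edges in `V` which lie in none of the translates `w k * V`. -/
def trunk (f : ι → G) (V : Set G) (w : κ → G) : Set (G × ι) :=
  {e | e ∈ edgesIn f V ∧ ∀ k, shift ι (w k)⁻¹ e ∉ edgesIn f V}

/-- The vertex `1` is connected inside `V` to a product of `n` elements of the family `w`. -/
def survival (f : ι → G) (V : Set G) (w : κ → G) (n : ℕ) : Set (Config (G × ι)) :=
  {ω | ∃ l : List κ, l.length = n ∧ Conn f (restr (edgesIn f V) ω) 1 (l.map w).prod}

lemma survival_determinedBy (V : Set G) (w : κ → G) (n : ℕ) :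
    DeterminedBy (survival f V w n) (edgesIn f V) :=
  determinedBy_setOf_restr
    (fun ω => ∃ l : List κ, l.length = n ∧ Conn f ω 1 (l.map w).prod) _

lemma measurableSet_survival [Countable G] [Countable ι] [Countable κ] (V : Set G) (w : κ → G)
    (n : ℕ) : MeasurableSet (survival f V w n) := by
  have : survival f V w n = ⋃ l : List κ, {_ω | l.length = n} ∩
      {ω | Conn f (restr (edgesIn f V) ω) 1 (l.map w).prod} := by
    ext ω; simp [survival]
  rw [this]
  exact MeasurableSet.iUnion fun l =>
    (MeasurableSet.const _).inter (measurableSet_conn_restr f _ _ _)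

lemma survival_succ_subset {V : Set G} {w : κ → G} (hV : ∀ k, ∀ v ∈ V, w k * v ∈ V) (n : ℕ)
    (k : κ) : {ω | Conn f (restr (trunk f V w) ω) 1 (w k)} ∩
      {ω | ω ∘ shift ι (w k) ∈ survival f V w n} ⊆ survival f V w (n + 1) := by
  rintro ω ⟨h1, l, hl, h2⟩
  refine ⟨k :: l, by simp [hl], ?_⟩
  have h3 : Conn f (restr (edgesIn f V) ω) 1 (w k) := Conn.restr_mono (fun e he => he.1) h1
  have h4 : Conn f (restr (edgesIn f V) ω ∘ shift ι (w k)) 1 (l.map w).prod := by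
    rw [restr_comp]
    have hsub : edgesIn f V ⊆ shift ι (w k) ⁻¹' edgesIn f V := fun e he =>
      ⟨hV k _ he.1, by simpa [shift, mul_assoc] using hV k _ he.2.1,
        by simpa [shift, mul_assoc] using he.2.2⟩
    exact Conn.restr_mono hsub h2
  have h5 := h4.of_shift
  rw [mul_one] at h5
  rw [List.map_cons, List.prod_cons]
  exact h3.trans h5

lemma exists_uniform_lower_bound {r : ℕ → ℝ} {m a c : ℝ} (h0 : r 0 = 1) (hm : 1 < m)
    (ha : 0 < a) (ha1 : a ≤ 1) (hc : 0 < c)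
    (h1 : ∀ n, a * r n ≤ r (n + 1)) (h2 : ∀ n, m * r n - c * r n ^ 2 ≤ r (n + 1)) :
    ∃ δ > 0, ∀ n, δ ≤ r n := by
  set ε := min 1 ((m - 1) / c)
  have hε : 0 < ε := lt_min one_pos (div_pos (by linarith) hc)
  refine ⟨a * ε, mul_pos ha hε, fun n => ?_⟩
  induction n with
  | zero =>
    rw [h0]
    exact mul_le_one₀ ha1 hε.le (min_le_left _ _)
  | succ n ih =>
    have hpos : 0 < r n := (mul_pos ha hε).trans_le ih
    rcases le_total ε (r n) with h | h
    · exact (mul_le_mul_of_nonneg_left h ha.le).trans (h1 n)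
    · have h3 : c * r n ≤ m - 1 := by
        have := (h.trans (min_le_right _ _))
        rw [le_div_iff₀ hc] at this
        linarith
      nlinarith [h2 n]

/-- If translates of the edges in `V` by the elements of a finite family `w` are disjoint and the
expected number of elements of the family connected to `1` outside these translates exceeds `1`,
then the cluster of the identity is infinite with positive probability. -/
theorem theta_pos_of_branching [Countable G] [Countable ι] [Fintype κ] {p : ℝ}
    (hp : p ∈ Set.Icc (0 : ℝ) 1) {μ : Measure (Config (G × ι))} (hμ : IsBernoulli p μ)
    {w : κ → G} {V : Set G} (h1V : 1 ∈ V) (hV : ∀ k, ∀ v ∈ V, w k * v ∈ V)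
    (hdisj : ∀ k l, ∀ v ∈ V, ∀ v' ∈ V, w k * v = w l * v' → k = l)
    (hone : ∀ k, ∀ v ∈ V, w k * v ≠ 1)
    (hm : 1 < ∑ k, μ.real {ω | Conn f (restr (trunk f V w) ω) 1 (w k)}) :
    0 < theta f μ := by
  classical
  have := hμ.isProbabilityMeasure
  set A : κ → Set (Config (G × ι)) := fun k => {ω | Conn f (restr (trunk f V w) ω) 1 (w k)}
  set U : ℕ → Set (Config (G × ι)) := survival f V w
  set U' : κ → ℕ → Set (Config (G × ι)) := fun k n => {ω | ω ∘ shift ι (w k) ∈ U n}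
  have hAm : ∀ k, MeasurableSet (A k) := fun k => measurableSet_conn_restr f _ _ _
  have hUm : ∀ n, MeasurableSet (U n) := fun n => measurableSet_survival V w n
  have hU'm : ∀ k n, MeasurableSet (U' k n) := fun k n =>
    (measurable_pi_lambda _ fun e => measurable_pi_apply _) (hUm n)
  set X : κ → Set (G × ι) := fun k => shift ι (w k)⁻¹ ⁻¹' edgesIn f V
  have hUd : ∀ k n, DeterminedBy (U' k n) (X k) := fun k n =>
    (survival_determinedBy V w n).comp (by ext e; simp [X, shift])
  have hAd : ∀ k, DeterminedBy (A k) (trunk f V w) := fun k =>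
    determinedBy_setOf_restr (fun ω => Conn f ω 1 (w k)) _
  have hAX : ∀ k, Disjoint (trunk f V w) (X k) := fun k =>
    Set.disjoint_left.2 fun e he he' => he.2 k he'
  have hXX : ∀ k l, k ≠ l → Disjoint (X k) (X l) := fun k l hkl =>
    Set.disjoint_left.2 fun e he he' => hkl (hdisj k l _ he.1 _ he'.1 (by simp [shift]))
  have hUr : ∀ k n, μ.real (U' k n) = μ.real (U n) := fun k n =>
    hμ.measure_preimage_comp hμ hp (shift_injective _) (hUm n)
  have hAU : ∀ k n, μ.real (A k ∩ U' k n) = μ.real (A k) * μ.real (U n) := fun k n => by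
    rw [hμ.real_inter hp (hAm k) (hU'm k n) (hAd k) (hUd k n) (hAX k), hUr]
  have hsub : ∀ k n, A k ∩ U' k n ⊆ U (n + 1) := fun k n => survival_succ_subset hV n k
  have hAone : ∀ k, μ.real (A k) ≤ 1 := fun k => measureReal_le_one
  obtain ⟨k₀, hk₀⟩ : ∃ k, 0 < μ.real (A k) := by
    by_contra! h
    linarith [Finset.sum_nonpos fun k (_ : k ∈ Finset.univ) => h k]
  obtain ⟨δ, hδ, hδU⟩ := exists_uniform_lower_bound (r := fun n => μ.real (U n))
    (m := ∑ k, μ.real (A k)) (a := μ.real (A k₀)) (c := (Fintype.card κ : ℝ) ^ 2)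
    (by
      have : U 0 = Set.univ := Set.eq_univ_of_forall fun ω => ⟨[], rfl, .refl⟩
      simp [this])
    hm hk₀ (hAone k₀) (by have : Nonempty κ := ⟨k₀⟩; positivity)
    (fun n => by
      rw [← hAU]
      exact measureReal_mono (hsub k₀ n))
    (fun n => by
      have h := sum_sub_le_measureReal_biUnion μ (A := fun k => A k ∩ U' k n)
        (fun k => (hAm k).inter (hU'm k n)) (sq_nonneg (μ.real (U n)))
        (fun k l hkl => by
          have : μ.real (U' k n ∩ U' l n) = μ.real (U n) ^ 2 := by
            rw [hμ.real_inter hp (hU'm k n) (hU'm l n) (hUd k n) (hUd l n) (hXX k l hkl), hUr,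
              hUr, sq]
          rw [← this]
          exact measureReal_mono (Set.inter_subset_inter Set.inter_subset_right
            Set.inter_subset_right)) Finset.univ
      simp only [hAU, ← Finset.sum_mul, Finset.card_univ] at h
      exact h.trans (measureReal_mono (Set.iUnion₂_subset fun k _ => hsub k n)))
  set D : ℕ → Set (Config (G × ι)) := fun n => ⋃ m ≥ n, U m
  have hDm : ∀ n, MeasurableSet (D n) := fun n =>
    MeasurableSet.iUnion fun m => MeasurableSet.iUnion fun _ => hUm m
  have hanti : Antitone D := fun n n' h =>
    Set.biUnion_subset_biUnion_left fun m hm => le_trans h hm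
  have hlim := tendsto_measure_iInter_atTop (μ := μ) (fun n => (hDm n).nullMeasurableSet) hanti
    ⟨0, measure_ne_top _ _⟩
  have hle : ENNReal.ofReal δ ≤ μ (⋂ n, D n) := by
    refine ge_of_tendsto' hlim fun n => ?_
    refine le_trans ?_ (measure_mono (Set.subset_biUnion_of_mem (u := U) (le_refl n)))
    rw [← ofReal_measureReal]
    exact ENNReal.ofReal_le_ofReal (hδU n)
  have hinf : ⋂ n, D n ⊆ {ω | (cluster f ω).Infinite} := by
    intro ω hω hfin
    have hinj : Function.Injective fun l : List κ => (l.map w).prod := fun l l' h =>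
      list_eq_of_prod_eq h1V hV hdisj hone h
    have hlist := (hfin.preimage hinj.injOn).image List.length
    obtain ⟨N, hN⟩ := hlist.bddAbove
    have h := Set.mem_iInter.1 hω (N + 1)
    simp only [D, Set.mem_iUnion] at h
    obtain ⟨n, hn, l, hl, hc⟩ := h
    have h2 : n ≤ N := hN ⟨l, Conn.of_restr hc, hl⟩
    lia
  refine ENNReal.toReal_pos (fun h => ?_) (measure_ne_top _ _)
  have h3 := hle.trans (measure_mono hinf)
  rw [h] at h3
  exact absurd h3 (by simpa using hδ)

end Branching

section Ball

variable {G : Type*} [Group G] {S : Set G} {m n : ℕ} {x y : G}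

lemma one_mem_ball (S : Set G) (n : ℕ) : (1 : G) ∈ ball S n := ⟨[], by simp, by simp, rfl⟩

lemma mul_mem_ball (hx : x ∈ ball S m) (hy : y ∈ ball S n) : x * y ∈ ball S (m + n) := by
  obtain ⟨l, hl, hS, rfl⟩ := hx
  obtain ⟨l', hl', hS', rfl⟩ := hy
  refine ⟨l ++ l', by simpa using add_le_add hl hl', fun x hx => ?_, by simp⟩
  exact (List.mem_append.1 hx).elim (hS x) (hS' x)

lemma ball_mono (hmn : m ≤ n) : ball S m ⊆ ball S n := by
  rintro _ ⟨l, hl, hS, rfl⟩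
  exact ⟨l, hl.trans hmn, hS, rfl⟩

lemma mem_ball_one (hx : x ∈ S) : x ∈ ball S 1 := ⟨[x], by simp, by simp [hx], by simp⟩

lemma inv_mem_ball_one (hx : x ∈ S) : x⁻¹ ∈ ball S 1 := ⟨[x⁻¹], by simp, by simp [hx], by simp⟩

lemma finite_ball (hS : S.Finite) (n : ℕ) : (ball S n).Finite := by
  induction n with
  | zero =>
    refine (Set.finite_singleton (1 : G)).subset ?_
    rintro _ ⟨l, hl, -, rfl⟩
    simp [List.eq_nil_of_length_eq_zero (Nat.le_zero.1 hl)]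
  | succ n ih =>
    have hS' : (S ∪ Inv.inv ⁻¹' S).Finite := hS.union (hS.preimage inv_injective.injOn)
    refine (ih.union (hS'.image2 (· * ·) ih)).subset ?_
    rintro _ ⟨l, hl, hS, rfl⟩
    cases l with
    | nil => exact .inl (one_mem_ball S n)
    | cons a l =>
      refine .inr ⟨a, hS a (by simp), l.prod, ⟨l, by simpa using hl, fun x hx => hS x ?_, rfl⟩, ?_⟩
      · exact List.mem_cons_of_mem a hx
      · simp

end Ball

section FiniteCriterion

variable {G ι : Type*} [Group G] {f : ι → G} {n : ℕ}

/-- The edges with both endpoints in the ball of radius `n`. -/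
def ballEdges (f : ι → G) (n : ℕ) : Set (G × ι) :=
  {e | e.1 ∈ ball (Set.range f) n ∧ e.1 * f e.2 ∈ ball (Set.range f) n}

/-- The cluster of `1` inside the ball of radius `n`. -/
def ballCluster (f : ι → G) (n : ℕ) (ω : Config (G × ι)) : Set G :=
  {x | Conn f (restr (ballEdges f n) ω) 1 x}

/-- The edges in the ball of radius `n` with an endpoint in `Q`. -/
def touchingEdges (f : ι → G) (n : ℕ) (Q : Set G) : Set (G × ι) :=
  {e | e ∈ ballEdges f n ∧ (e.1 ∈ Q ∨ e.1 * f e.2 ∈ Q)}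

/-- `x` is connected to a vertex outside the ball of radius `k` about `x`, using only edges
in `X`. -/
def escape (f : ι → G) (k : ℕ) (X : Set (G × ι)) (x : G) : Set (Config (G × ι)) :=
  {ω | ∃ y, x⁻¹ * y ∉ ball (Set.range f) k ∧ Conn f (restr X ω) x y}

lemma Conn.step_of_open {ω : Config (G × ι)} {x a : G} {i : ι} (h : Conn f ω x a)
    (ho : ω (a, i) = true) : Conn f ω x (a * f i) :=
  h.tail (Step.of_open ho)

lemma Conn.step_of_open' {ω : Config (G × ι)} {x a : G} {i : ι} (h : Conn f ω x (a * f i))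
    (ho : ω (a, i) = true) : Conn f ω x a :=
  h.tail (Step.of_open ho).symm

/-- Induction along a path of open edges, in which edges may be traversed in both directions. -/
lemma Conn.induction {ω : Config (G × ι)} {x y : G} {P : G → Prop} (h : Conn f ω x y)
    (h0 : P x) (h1 : ∀ a i, ω (a, i) = true → (P a ↔ P (a * f i))) : P y := by
  induction h with
  | refl => exact h0
  | tail _ hs ih =>
    obtain ⟨i, ⟨ho, rfl⟩ | ⟨ho, rfl⟩⟩ := hs
    · exact (h1 _ _ ho).1 ih
    · exact (h1 _ _ ho).2 ih

lemma ballCluster_subset_ball (f : ι → G) (n : ℕ) (ω : Config (G × ι)) :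
    ballCluster f n ω ⊆ ball (Set.range f) n := fun _ hx =>
  Conn.induction (P := (· ∈ ball (Set.range f) n)) hx (one_mem_ball _ _) fun _ _ ho =>
    have := (restr_eq_true.1 ho).1
    ⟨fun _ => this.2, fun _ => this.1⟩

lemma ballCluster_determinedBy (Q : Set G) :
    DeterminedBy {ω | ballCluster f n ω = Q} (touchingEdges f n Q) := by
  have hsub : touchingEdges f n Q ⊆ ballEdges f n := fun e he => he.1
  have key : ∀ ω, restr (ballEdges f n) (restr (touchingEdges f n Q) ω) =
      restr (touchingEdges f n Q) ω := fun ω => by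
    rw [restr_restr, Set.inter_eq_right.2 hsub]
  have hle : ∀ ω, ballCluster f n (restr (touchingEdges f n Q) ω) ⊆ ballCluster f n ω :=
    fun ω x (hx : Conn f _ 1 x) => by
      rw [key] at hx
      exact hx.restr_mono hsub
  intro ω
  constructor
  · intro (h : ballCluster f n _ = Q)
    refine (h.symm.subset.trans (hle ω)).antisymm' fun x hx => ?_
    refine Conn.induction (P := (· ∈ Q)) hx (h ▸ .refl) fun a i ho => ?_
    have ho' := restr_eq_true.1 ho
    constructor
    · intro ha
      have hT : restr (touchingEdges f n Q) ω (a, i) = true :=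
        restr_eq_true.2 ⟨⟨ho'.1, .inl ha⟩, ho'.2⟩
      rw [← key] at hT
      rw [← h] at ha ⊢
      exact Conn.step_of_open ha hT
    · intro ha
      have hT : restr (touchingEdges f n Q) ω (a, i) = true :=
        restr_eq_true.2 ⟨⟨ho'.1, .inr ha⟩, ho'.2⟩
      rw [← key] at hT
      rw [← h] at ha ⊢
      exact Conn.step_of_open' ha hT
  · intro (h : ballCluster f n ω = Q)
    refine ((hle ω).trans h.subset).antisymm fun x hx => ?_
    rw [← h] at hx
    have : x ∈ ballCluster f n ω ∧ x ∈ ballCluster f n (restr (touchingEdges f n Q) ω) := by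
      refine Conn.induction (P := fun x => x ∈ ballCluster f n ω ∧
        x ∈ ballCluster f n (restr (touchingEdges f n Q) ω)) hx ⟨.refl, .refl⟩ fun a i ho => ?_
      have ho' := restr_eq_true.1 ho
      constructor
      · rintro ⟨h1, h2⟩
        refine ⟨Conn.step_of_open h1 ho, Conn.step_of_open h2 ?_⟩
        rw [key]
        exact restr_eq_true.2 ⟨⟨ho'.1, .inl (h ▸ h1)⟩, ho'.2⟩
      · rintro ⟨h1, h2⟩
        refine ⟨Conn.step_of_open' h1 ho, Conn.step_of_open' h2 ?_⟩
        rw [key]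
        exact restr_eq_true.2 ⟨⟨ho'.1, .inr (h ▸ h1)⟩, ho'.2⟩
    exact this.2

/-- A vertex connected to `1` lies in the cluster of `1` in the ball, or is connected to a boundary
vertex of this cluster by a path which avoids the edges in the ball touching the cluster. -/
lemma Conn.mem_ballCluster_or {ω : Config (G × ι)} {y : G} (h : Conn f ω 1 y) (n : ℕ) :
    y ∈ ballCluster f (n + 1) ω ∨ ∃ x ∈ ballCluster f (n + 1) ω, x ∉ ball (Set.range f) n ∧
      Conn f (restr (touchingEdges f (n + 1) (ballCluster f (n + 1) ω))ᶜ ω) x y := by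
  set C := ballCluster f (n + 1) ω
  have hCb : C ⊆ ball (Set.range f) (n + 1) := ballCluster_subset_ball f (n + 1) ω
  have main : ∀ a b, Step f ω a b →
      (∀ (X : Set (G × ι)), (∀ i, ((a, i) ∈ X ∨ b ≠ a * f i) ∧ ((b, i) ∈ X ∨ a ≠ b * f i)) →
        Step f (restr X ω) a b) := by
    rintro a b ⟨i, ⟨ho, hb⟩ | ⟨ho, ha⟩⟩ X hX
    · exact ⟨i, .inl ⟨restr_eq_true.2 ⟨(hX i).1.resolve_right (· hb), ho⟩, hb⟩⟩
    · exact ⟨i, .inr ⟨restr_eq_true.2 ⟨(hX i).2.resolve_right (· ha), ho⟩, ha⟩⟩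
  have hnb : ∀ a b, Step f ω a b → a ∈ ball (Set.range f) n → b ∈ ball (Set.range f) (n + 1) := by
    rintro a b ⟨i, ⟨ho, rfl⟩ | ⟨ho, rfl⟩⟩ ha
    · exact mul_mem_ball ha (mem_ball_one ⟨i, rfl⟩)
    · simpa using mul_mem_ball ha (inv_mem_ball_one (S := Set.range f) ⟨i, rfl⟩)
  have hCs : ∀ a b, Step f ω a b → a ∈ C → b ∈ ball (Set.range f) (n + 1) → b ∈ C := by
    intro a b hs ha hb
    refine Relation.ReflTransGen.tail ha (main a b hs _ fun i => ?_)
    by_cases h1 : b = a * f i <;> by_cases h2 : a = b * f i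
    · exact ⟨.inl ⟨hCb ha, h1 ▸ hb⟩, .inl ⟨hb, h2 ▸ hCb ha⟩⟩
    · exact ⟨.inl ⟨hCb ha, h1 ▸ hb⟩, .inr h2⟩
    · exact ⟨.inr h1, .inl ⟨hb, h2 ▸ hCb ha⟩⟩
    · exact ⟨.inr h1, .inr h2⟩
  induction h with
  | refl => exact .inl .refl
  | @tail a b _ hs ih =>
    by_cases hb : b ∈ C
    · exact .inl hb
    right
    have hT : ∀ i, ((a, i) ∈ (touchingEdges f (n + 1) C)ᶜ ∨ b ≠ a * f i) ∧
        ((b, i) ∈ (touchingEdges f (n + 1) C)ᶜ ∨ a ≠ b * f i) := by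
      intro i
      constructor
      · by_contra! hcon
        obtain ⟨hcon, rfl⟩ := hcon
        obtain ⟨h1, h2⟩ := not_not.1 hcon
        exact hb (hCs _ _ hs (h2.resolve_right hb) h1.2)
      · by_contra! hcon
        obtain ⟨hcon, rfl⟩ := hcon
        obtain ⟨h1, h2⟩ := not_not.1 hcon
        exact hb (hCs _ _ hs (h2.resolve_left hb) h1.1)
    have hs' := main a b hs _ hT
    rcases ih with ha | ⟨x, hx, hxn, hxa⟩
    · exact ⟨a, ha, fun han => hb (hCs _ _ hs ha (hnb _ _ hs han)), .single hs'⟩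
    · exact ⟨x, hx, hxn, Relation.ReflTransGen.tail hxa hs'⟩

lemma measurableSet_escape [Countable G] [Countable ι] (f : ι → G) (k : ℕ) (X : Set (G × ι))
    (x : G) : MeasurableSet (escape f k X x) := by
  have : escape f k X x = ⋃ y, {_ω | x⁻¹ * y ∉ ball (Set.range f) k} ∩
      {ω | Conn f (restr X ω) x y} := by
    ext ω; simp [escape]
  rw [this]
  exact MeasurableSet.iUnion fun y =>
    (MeasurableSet.const _).inter (measurableSet_conn_restr f _ _ _)

lemma measurableSet_ballCluster_eq [Countable G] [Countable ι] (f : ι → G) (n : ℕ) (Q : Set G) :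
    MeasurableSet {ω | ballCluster f n ω = Q} := by
  have : {ω | ballCluster f n ω = Q} =
      ⋂ x, {ω | Conn f (restr (ballEdges f n) ω) 1 x ↔ x ∈ Q} := by
    ext ω; simp [ballCluster, Set.ext_iff]
  rw [this]
  exact MeasurableSet.iInter fun x =>
    (measurableSet_conn_restr f _ 1 x).iff (MeasurableSet.const _)

/-- If the expected number of boundary vertices of a ball which are connected to its centre inside
the ball is smaller than `1`, then there is no infinite cluster. -/
theorem theta_eq_zero_of_sum_lt_one [Countable G] [Finite ι] {p : ℝ} (hp : p ∈ Set.Icc (0 : ℝ) 1)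
    {μ : Measure (Config (G × ι))} (hμ : IsBernoulli p μ) (s : Finset G)
    (hs : ball (Set.range f) (n + 1) \ ball (Set.range f) n ⊆ s)
    (hlt : ∑ x ∈ s, μ.real {ω | Conn f (restr (ballEdges f (n + 1)) ω) 1 x} < 1) :
    theta f μ = 0 := by
  classical
  have := hμ.isProbabilityMeasure
  set φ := ∑ x ∈ s, μ.real {ω | Conn f (restr (ballEdges f (n + 1)) ω) 1 x}
  have hφ0 : 0 ≤ φ := Finset.sum_nonneg fun _ _ => measureReal_nonneg
  set r : ℕ → ℝ := fun k => μ.real (escape f k Set.univ 1)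
  have hfin : ∀ n, (ball (Set.range f) n).Finite := finite_ball (Set.finite_range f)
  have hesc : ∀ k X x, μ.real (escape f k X x) ≤ r k := by
    intro k X x
    refine le_trans (measureReal_mono ?_) (hμ.measure_preimage_comp hμ hp (shift_injective x)
      (measurableSet_escape f k Set.univ 1)).le
    rintro ω ⟨y, hy, h⟩
    refine ⟨x⁻¹ * y, by simpa using hy, ?_⟩
    have h1 : Conn f ω (x * 1) (x * (x⁻¹ * y)) := by simpa using h.of_restr
    exact (conn_shift x |>.2 h1).mono fun e he => restr_eq_true.2 ⟨Set.mem_univ _, he⟩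
  set P := (hfin (n + 1)).toFinset.powerset
  have hstep : ∀ k, r (n + 1 + k) ≤ φ * r k := by
    intro k
    have hsub : escape f (n + 1 + k) Set.univ 1 ⊆ ⋃ x ∈ s, ⋃ Q ∈ P.filter (x ∈ ·),
        {ω | ballCluster f (n + 1) ω = Q} ∩ escape f k (touchingEdges f (n + 1) Q)ᶜ x := by
      rintro ω ⟨y, hy, h⟩
      have hyb : y ∉ ball (Set.range f) (n + 1 + k) := by simpa using hy
      have hCb := ballCluster_subset_ball f (n + 1) ω
      have hCfin := (hfin (n + 1)).subset hCb
      rcases h.of_restr.mem_ballCluster_or n with hyC | ⟨x, hxC, hxn, hxy⟩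
      · exact (hyb (ball_mono (by lia) (hCb hyC))).elim
      · refine Set.mem_iUnion₂.2 ⟨x, hs ⟨hCb hxC, hxn⟩, Set.mem_iUnion₂.2
          ⟨hCfin.toFinset, ?_, ?_, y, fun hxy => hyb ?_, ?_⟩⟩
        · simp only [P, Finset.mem_filter, Finset.mem_powerset, Set.Finite.mem_toFinset]
          exact ⟨Set.Finite.toFinset_mono hCb, hxC⟩
        · simp
        · simpa using mul_mem_ball (hCb hxC) hxy
        · rwa [Set.Finite.coe_toFinset]
    calc r (n + 1 + k) ≤ _ := measureReal_mono hsub (measure_ne_top _ _)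
      _ ≤ ∑ x ∈ s, ∑ Q ∈ P.filter (x ∈ ·), μ.real ({ω | ballCluster f (n + 1) ω = Q} ∩
          escape f k (touchingEdges f (n + 1) Q)ᶜ x) :=
        (measureReal_biUnion_finset_le _ _).trans
          (Finset.sum_le_sum fun x _ => measureReal_biUnion_finset_le _ _)
      _ ≤ ∑ x ∈ s, ∑ Q ∈ P.filter (x ∈ ·), μ.real {ω | ballCluster f (n + 1) ω = Q} * r k := by
        refine Finset.sum_le_sum fun x _ => Finset.sum_le_sum fun Q _ => ?_
        rw [hμ.real_inter hp (measurableSet_ballCluster_eq f _ _) (measurableSet_escape f _ _ _)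
          (ballCluster_determinedBy _) (determinedBy_setOf_restr
            (fun ω => ∃ y, x⁻¹ * y ∉ ball (Set.range f) k ∧ Conn f ω x y) _) disjoint_compl_right]
        exact mul_le_mul_of_nonneg_left (hesc _ _ _) measureReal_nonneg
      _ ≤ φ * r k := by
        simp only [← Finset.sum_mul]
        refine mul_le_mul_of_nonneg_right (Finset.sum_le_sum fun x _ => ?_) measureReal_nonneg
        rw [← measureReal_biUnion_finset]
        · refine measureReal_mono (Set.iUnion₂_subset fun Q hQ ω hω => ?_)
          have hx : x ∈ (Q : Set G) := (Finset.mem_filter.1 hQ).2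
          have hω' : ballCluster f (n + 1) ω = Q := hω
          rw [← hω'] at hx
          exact hx
        · intro Q _ Q' _ hne
          refine Set.disjoint_left.2 fun ω h1 h2 => hne ?_
          exact Finset.coe_injective (Eq.trans (Eq.symm h1) h2)
        · exact fun Q _ => measurableSet_ballCluster_eq f _ _
  have hpow : ∀ j, r (j * (n + 1)) ≤ φ ^ j := by
    intro j
    induction j with
    | zero => simpa using measureReal_le_one
    | succ j ih =>
      rw [show (j + 1) * (n + 1) = n + 1 + j * (n + 1) by ring, pow_succ']
      exact (hstep _).trans (mul_le_mul_of_nonneg_left ih hφ0)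
  have htheta : ∀ j, theta f μ ≤ φ ^ j := by
    intro j
    refine le_trans (measureReal_mono fun ω (hω : (cluster f ω).Infinite) => ?_) (hpow j)
    obtain ⟨y, hy, hyb⟩ := hω.exists_notMem_finset (hfin (j * (n + 1))).toFinset
    have hy' : Conn f ω 1 y := hy
    exact ⟨y, by simpa using hyb, hy'.mono fun e he => restr_eq_true.2 ⟨Set.mem_univ _, he⟩⟩
  exact le_antisymm (ge_of_tendsto' (tendsto_pow_atTop_nhds_zero_of_lt_one hφ0 hlt) htheta)
    ENNReal.toReal_nonneg

end FiniteCriterion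

section Generation

variable {G : Type*} [Group G] {S : Set G}

lemma exists_mem_ball (hgen : Subgroup.closure S = ⊤) (g : G) : ∃ n, g ∈ ball S n := by
  have hg : g ∈ Subgroup.closure S := hgen ▸ Subgroup.mem_top g
  induction hg using Subgroup.closure_induction_left with
  | one => exact ⟨0, one_mem_ball S 0⟩
  | mul_left x hx y _ ih =>
    obtain ⟨n, hn⟩ := ih
    exact ⟨_, mul_mem_ball (mem_ball_one hx) hn⟩
  | inv_mul_cancel x hx y _ ih =>
    obtain ⟨n, hn⟩ := ih
    exact ⟨_, mul_mem_ball (inv_mem_ball_one hx) hn⟩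

lemma countable_of_closure_eq_top (hfin : S.Finite) (hgen : Subgroup.closure S = ⊤) :
    Countable G := by
  rw [← Set.countable_univ_iff]
  refine (Set.countable_iUnion fun n => (finite_ball hfin n).countable).mono fun g _ => ?_
  exact Set.mem_iUnion.2 (exists_mem_ball hgen g)

end Generation

section FreeProduct

open Monoid Monoid.CoprodI

variable {n : ℕ} {G : Fin n → Type*} [∀ i, Group (G i)]

/-- The list of syllables of the normal form of `x`. -/
noncomputable def syllables (x : CoprodI G) : List (Σ i, G i) := by
  classical exact (Word.equiv x).toList

lemma syllables_injective : (syllables (G := G)).Injective := by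
  classical
  intro x y h
  refine Word.equiv.injective (Word.ext ?_)
  simpa [syllables] using h

lemma syllables_one : syllables (1 : CoprodI G) = [] := by
  classical
  change ((1 : CoprodI G) • (Word.empty : Word G)).toList = []
  rw [one_smul]
  rfl

lemma syllables_of_mul {i : Fin n} {g : G i} (hg : g ≠ 1) {x : CoprodI G}
    (hx : ∀ a ∈ (syllables x).head?, a.1 ≠ i) :
    syllables (of g * x) = ⟨i, g⟩ :: syllables x := by
  classical
  have h1 : (Word.equiv x).fstIdx ≠ some i :=
    Word.fstIdx_ne_iff.2 fun l hl => (hx l (by unfold syllables; convert hl)).symm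
  have h2 : syllables (of g * x) = (Word.cons g (Word.equiv x) h1 hg).toList := by
    rw [Word.cons_eq_smul]
    change ((of g * x) • (Word.empty : Word G)).toList =
      (of g • x • (Word.empty : Word G)).toList
    rw [mul_smul]
  rw [h2]
  simp only [syllables, Word.cons]

lemma syllables_of {i : Fin n} {g : G i} (hg : g ≠ 1) :
    syllables (of g) = [⟨i, g⟩] := by
  have := syllables_of_mul hg (x := (1 : CoprodI G)) (by simp [syllables_one])
  simpa [syllables_one] using this

lemma countable_coprodI [∀ i, Countable (G i)] : Countable (CoprodI G) :=
  syllables_injective.countable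

/-- The elements whose normal form is empty or begins with a syllable in `G i`. -/
def beginsAt (i : Fin n) : Set (CoprodI G) := {x | ∀ a ∈ (syllables x).head?, a.1 = i}

variable {i₀ : Fin n}

/-- The product of a syllable in `G i₀` and another syllable. -/
def twoSyllables (k : G i₀ × Σ j, G j) : CoprodI G := of k.1 * of k.2.2

lemma syllables_twoSyllables_mul {k : G i₀ × Σ j, G j} (h1 : k.1 ≠ 1) (h2 : k.2.1 ≠ i₀)
    (h3 : k.2.2 ≠ 1) {v : CoprodI G} (hv : v ∈ beginsAt i₀) :
    syllables (twoSyllables k * v) = ⟨i₀, k.1⟩ :: k.2 :: syllables v := by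
  have h : syllables (of k.2.2 * v) = k.2 :: syllables v :=
    syllables_of_mul h3 fun a ha => by rw [hv a ha]; exact h2.symm
  rw [twoSyllables, mul_assoc, syllables_of_mul h1, h]
  rw [h]
  simpa using h2

variable {S : ∀ i, Set (G i)}

lemma length_syllables_of_le (i : Fin n) (g : G i) : (syllables (of g)).length ≤ 1 := by
  by_cases hg : g = 1
  · simp [hg, syllables_one]
  · simp [syllables_of hg]

lemma syllables_of_mul_of {g : G i₀} (hg : g ≠ 1) {j : Fin n} (hj : j ≠ i₀) (h : G j) :
    syllables (of g * of h) = ⟨i₀, g⟩ :: syllables (of h) := by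
  refine syllables_of_mul hg ?_
  by_cases hh : h = 1
  · simp [hh, syllables_one]
  · simpa [syllables_of hh] using hj

variable {B : Finset (G i₀)} {B' : Finset (Σ j, G j)}

/-- The words with first syllable in `B` and second syllable in `B'`. -/
def branch (B : Finset (G i₀)) (B' : Finset (Σ j, G j)) (k : B × B') : CoprodI G :=
  twoSyllables ((k.1 : G i₀), (k.2 : Σ j, G j))

lemma syllables_branch_mul (hB : 1 ∉ B) (hB' : ∀ s ∈ B', s.1 ≠ i₀ ∧ s.2 ≠ 1) (k : B × B')
    {v : CoprodI G} (hv : v ∈ beginsAt i₀) :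
    syllables (branch B B' k * v) = ⟨i₀, k.1⟩ :: (k.2 : Σ j, G j) :: syllables v :=
  syllables_twoSyllables_mul (fun h => hB (h ▸ k.1.2)) (hB' _ k.2.2).1 (hB' _ k.2.2).2 hv

lemma not_mem_edgesIn_of_length_lt_two (hB : 1 ∉ B) (hB' : ∀ s ∈ B', s.1 ≠ i₀ ∧ s.2 ≠ 1)
    {e : CoprodI G × Σ i, S i} (he : (syllables e.1).length < 2) (k : B × B') :
    shift _ (branch B B' k)⁻¹ e ∉ edgesIn (coprodIGens S) (beginsAt i₀) := by
  intro h
  have := syllables_branch_mul hB hB' k h.1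
  rw [shift, mul_inv_cancel_left] at this
  rw [this] at he
  simp at he

/-- The copy of an edge of `G i` in the coset `x * G i`. -/
def cosetEdge (S : ∀ i, Set (G i)) (i : Fin n) (x : CoprodI G) (e : G i × S i) :
    CoprodI G × Σ i, S i := (x * of e.1, ⟨i, e.2⟩)

lemma cosetEdge_injective (i : Fin n) (x : CoprodI G) : (cosetEdge S i x).Injective := by
  rintro ⟨a, s⟩ ⟨b, t⟩ h
  simp only [cosetEdge, Prod.mk.injEq, mul_right_inj, Sigma.mk.injEq, heq_eq_eq, true_and] at h
  exact Prod.ext (of_injective i h.1) h.2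

lemma cosetEdge_snd (i : Fin n) (x : CoprodI G) (e : G i × S i) :
    (cosetEdge S i x e).1 * coprodIGens S (cosetEdge S i x e).2 =
      x * of (e.1 * setGens (S i) e.2) := by
  simp only [cosetEdge, coprodIGens, setGens, mul_assoc, map_mul]
  rfl

lemma conn_of_cosetEdge {i : Fin n} {x : CoprodI G} {ω : Config (CoprodI G × Σ i, S i)}
    {X : Set (CoprodI G × Σ i, S i)}
    (hX : ∀ e : G i × S i, e.1 ≠ e.1 * setGens (S i) e.2 → cosetEdge S i x e ∈ X) {a b : G i}
    (h : Conn (setGens (S i)) (ω ∘ cosetEdge S i x) a b) :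
    Conn (coprodIGens S) (restr X ω) (x * of a) (x * of b) := by
  refine h.map (fun a => x * of a) fun a s hs hne => ?_
  have := Step.of_open (f := coprodIGens S) (ω := restr X ω) (a := x * of a) (i := ⟨i, s⟩)
    (restr_eq_true.2 ⟨hX (a, s) hne, hs⟩)
  convert this using 1
  exact (cosetEdge_snd i x (a, s)).symm

lemma cosetEdge_one_mem_trunk (hB : 1 ∉ B) (hB' : ∀ s ∈ B', s.1 ≠ i₀ ∧ s.2 ≠ 1)
    (e : G i₀ × S i₀) (he : e.1 ≠ e.1 * setGens (S i₀) e.2) :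
    cosetEdge S i₀ 1 e ∈ trunk (coprodIGens S) (beginsAt i₀) (branch B B') := by
  have hmem : ∀ g : G i₀, (of g : CoprodI G) ∈ beginsAt i₀ := fun g => by
    by_cases hg : g = 1
    · simp [hg, beginsAt, syllables_one]
    · simp [beginsAt, syllables_of hg]
  refine ⟨⟨by simpa [cosetEdge] using hmem e.1, ?_, ?_⟩, not_mem_edgesIn_of_length_lt_two hB hB' ?_⟩
  · rw [cosetEdge_snd, one_mul]
    exact hmem _
  · rw [cosetEdge_snd]
    simpa [cosetEdge] using fun h => he (of_injective i₀ (by simpa using h))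
  · simpa [cosetEdge] using Nat.lt_succ_of_le (length_syllables_of_le i₀ e.1)

lemma cosetEdge_of_mem_trunk (hB : 1 ∉ B) (hB' : ∀ s ∈ B', s.1 ≠ i₀ ∧ s.2 ≠ 1) {g : G i₀}
    (hg : g ≠ 1) {j : Fin n} (hj : j ≠ i₀) (e : G j × S j)
    (he : e.1 ≠ e.1 * setGens (S j) e.2) :
    cosetEdge S j (of g) e ∈ trunk (coprodIGens S) (beginsAt i₀) (branch B B') := by
  have hmem : ∀ h : G j, (of g * of h : CoprodI G) ∈ beginsAt i₀ := fun h => by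
    simp [beginsAt, syllables_of_mul_of hg hj h]
  have hne : (cosetEdge S j (of g) e).1 ≠
      (cosetEdge S j (of g) e).1 * coprodIGens S (cosetEdge S j (of g) e).2 := by
    rw [cosetEdge_snd]
    exact fun h => he (of_injective j (mul_left_cancel h))
  refine ⟨⟨hmem e.1, ?_, hne⟩, fun k hk => ?_⟩
  · rw [cosetEdge_snd]
    exact hmem _
  have key : ∀ h : G j, (branch B B' k)⁻¹ * (of g * of h) ∈ beginsAt i₀ →
      syllables (of h : CoprodI G) = [(k.2 : Σ j, G j)] := fun h hh => by
    have h1 := syllables_branch_mul hB hB' k hh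
    rw [mul_inv_cancel_left, syllables_of_mul_of hg hj, List.cons.injEq] at h1
    have h2 := length_syllables_of_le j h
    rw [h1.2] at h2 ⊢
    simpa using h2
  have h1 := key e.1 hk.1
  have h2 := key (e.1 * setGens (S j) e.2) (by
    have := hk.2.1
    rwa [shift, mul_assoc, cosetEdge_snd] at this)
  exact he (of_injective j (syllables_injective (h1.trans h2.symm)))

theorem theta_coprodI_pos [∀ i, Countable (G i)] [∀ i, Countable (S i)] {p : ℝ}
    (hp : p ∈ Set.Icc (0 : ℝ) 1) {μi : ∀ i, Measure (Config (G i × S i))}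
    (hμi : ∀ i, IsBernoulli p (μi i)) {μ : Measure (Config (CoprodI G × Σ i, S i))}
    (hμ : IsBernoulli p μ) (hB : 1 ∉ B) (hB' : ∀ s ∈ B', s.1 ≠ i₀ ∧ s.2 ≠ 1)
    (h : 1 < (∑ g ∈ B, (μi i₀).real {ω | Conn (setGens (S i₀)) ω 1 g}) *
      ∑ s ∈ B', (μi s.1).real {ω | Conn (setGens (S s.1)) ω 1 s.2}) :
    0 < theta (coprodIGens S) μ := by
  have := countable_coprodI (G := G)
  have := hμ.isProbabilityMeasure
  refine theta_pos_of_branching hp hμ (w := branch B B') (V := beginsAt i₀)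
    (by simp [beginsAt, syllables_one]) (fun k v hv => ?_) (fun k l v hv v' hv' hvv => ?_)
    (fun k v hv hvk => ?_) (h.trans_le ?_)
  · simp [beginsAt, syllables_branch_mul hB hB' k hv]
  · have h1 := congrArg syllables hvv
    rw [syllables_branch_mul hB hB' k hv, syllables_branch_mul hB hB' l hv'] at h1
    simp only [List.cons.injEq, Sigma.mk.injEq, heq_eq_eq, true_and] at h1
    exact Prod.ext (Subtype.ext h1.1) (Subtype.ext h1.2.1)
  · have h1 := congrArg syllables hvk
    rw [syllables_branch_mul hB hB' k hv, syllables_one] at h1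
    simp at h1
  rw [← Finset.sum_coe_sort B, ← Finset.sum_coe_sort B', Finset.sum_mul_sum,
    ← Finset.sum_product', Finset.univ_product_univ]
  refine Finset.sum_le_sum fun k _ => ?_
  obtain ⟨⟨g, hg⟩, ⟨⟨j, s⟩, hs⟩⟩ := k
  have hg1 : g ≠ 1 := fun h => hB (h ▸ hg)
  obtain ⟨hj, -⟩ := hB' _ hs
  simp only at hj ⊢
  have m1 := measurableSet_conn (setGens (S i₀)) 1 g
  have m2 := measurableSet_conn (setGens (S j)) 1 s
  have hmeas : ∀ {i} (x : CoprodI G), Measurable fun ω : Config (CoprodI G × Σ i, S i) =>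
      ω ∘ cosetEdge S i x := fun x => measurable_pi_lambda _ fun e => measurable_pi_apply _
  have hdet : ∀ {i} (x : CoprodI G) (t : Set (Config (G i × S i))),
      DeterminedBy {ω | ω ∘ cosetEdge S i x ∈ t} (Set.range (cosetEdge S i x)) := fun x t =>
    DeterminedBy.comp (X := Set.univ) (fun ω => by
      rw [show restr Set.univ ω = ω by classical funext e; simp [restr]]) (by simp)
  have hdisj : Disjoint (Set.range (cosetEdge S i₀ 1)) (Set.range (cosetEdge S j (of g))) := by
    rw [Set.disjoint_left]
    rintro _ ⟨e, rfl⟩ ⟨e', h'⟩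
    exact hj (congrArg (fun e => e.2.1) h')
  rw [← hμ.measure_preimage_comp (hμi i₀) hp (cosetEdge_injective i₀ 1) m1,
    ← hμ.measure_preimage_comp (hμi j) hp (cosetEdge_injective j (of g)) m2]
  refine (hμ.real_inter hp (hmeas _ m1) (hmeas _ m2) (hdet _ _) (hdet _ _) hdisj).symm.trans_le
    (measureReal_mono ?_ (measure_ne_top _ _))
  rintro ω ⟨h1, h2⟩
  have h3 := conn_of_cosetEdge (cosetEdge_one_mem_trunk hB hB') h1
  have h4 := conn_of_cosetEdge (cosetEdge_of_mem_trunk hB hB' hg1 hj) h2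
  simp only [map_one, one_mul, mul_one] at h3 h4
  exact Relation.ReflTransGen.trans h3 h4

end FreeProduct

section CriticalProbability

variable {G ι : Type*} [Group G] {f : ι → G}

lemma pc_mem_Icc (f : ι → G) (μ : ℝ → Measure (Config (G × ι))) : pc f μ ∈ Set.Icc (0 : ℝ) 1 := by
  have h : ∀ p ∈ ({p | p ∈ Set.Icc (0 : ℝ) 1 ∧ 0 < theta f (μ p)} ∪ {1} : Set ℝ), 0 ≤ p := by
    rintro p (hp | rfl)
    exacts [hp.1.1, zero_le_one]
  exact ⟨le_csInf ⟨1, .inr rfl⟩ h, csInf_le ⟨0, h⟩ (.inr rfl)⟩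

lemma theta_eq_zero_of_lt_pc {μ : ℝ → Measure (Config (G × ι))} {p : ℝ}
    (hp : p ∈ Set.Icc (0 : ℝ) 1) (h : p < pc f μ) : theta f (μ p) = 0 := by
  refine (ENNReal.toReal_nonneg.eq_or_lt').resolve_right fun hpos => h.not_ge (csInf_le ⟨0, ?_⟩
    (.inl ⟨hp, hpos⟩))
  rintro p (hp | rfl)
  exacts [hp.1.1, zero_le_one]

lemma exists_theta_pos_of_pc_lt {μ : ℝ → Measure (Config (G × ι))} {r : ℝ} (h1 : pc f μ < 1)
    (hr : pc f μ < r) : ∃ p ∈ Set.Icc (0 : ℝ) 1, pc f μ ≤ p ∧ p < r ∧ 0 < theta f (μ p) := by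
  obtain ⟨p, hp, hpr⟩ := exists_lt_of_csInf_lt ⟨1, .inr rfl⟩ (lt_min h1 hr)
  obtain hp | rfl := hp
  · refine ⟨p, hp.1, not_lt.1 fun h => ?_, hpr.trans_le (min_le_right _ _), hp.2⟩
    exact hp.2.ne' (theta_eq_zero_of_lt_pc hp.1 h)
  · exact absurd (hpr.trans_le (min_le_left _ _)) (lt_irrefl _)

lemma exists_open_imp_conn {S : Set G} (hgen : Subgroup.closure S = ⊤) (g : G) :
    ∃ F : Finset (G × S), ∀ ω : Config (G × S), (∀ e ∈ F, ω e = true) →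
      Conn (setGens S) ω 1 g := by
  classical
  have hg : g ∈ Subgroup.closure S := hgen ▸ Subgroup.mem_top g
  induction hg using Subgroup.closure_induction_right with
  | one => exact ⟨∅, fun _ _ => Relation.ReflTransGen.refl⟩
  | mul_right x _ y hy ih =>
    obtain ⟨F, hF⟩ := ih
    refine ⟨insert (x, ⟨y, hy⟩) F, fun ω hω => ?_⟩
    exact (hF ω fun e he => hω e (Finset.mem_insert_of_mem he)).step_of_open
      (hω _ (Finset.mem_insert_self _ _))
  | mul_inv_cancel x _ y hy ih =>
    obtain ⟨F, hF⟩ := ih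
    refine ⟨insert (x * y⁻¹, ⟨y, hy⟩) F, fun ω hω => ?_⟩
    refine Conn.step_of_open' ?_ (hω _ (Finset.mem_insert_self _ _))
    simpa [setGens] using hF ω fun e he => hω e (Finset.mem_insert_of_mem he)

lemma exists_pow_le_real_conn {S : Set G} (hgen : Subgroup.closure S = ⊤) (g : G) :
    ∃ L : ℕ, ∀ p ∈ Set.Icc (0 : ℝ) 1, ∀ μ : Measure (Config (G × S)), IsBernoulli p μ →
      p ^ L ≤ μ.real {ω | Conn (setGens S) ω 1 g} := by
  obtain ⟨F, hF⟩ := exists_open_imp_conn hgen g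
  refine ⟨F.card, fun p hp μ hμ => ?_⟩
  have := hμ.isProbabilityMeasure
  have h1 : μ.real {ω | ∀ e ∈ F, ω e = true} = p ^ F.card := by
    rw [measureReal_def, hμ F fun _ => true]
    simp [ENNReal.toReal_ofReal hp.1]
  rw [← h1]
  exact measureReal_mono hF (measure_ne_top _ _)

lemma real_conn_restr_eq_zero [Countable G] [Countable ι] {μ : Measure (Config (G × ι))}
    (hμ : IsBernoulli 0 μ) (X : Set (G × ι)) {x : G} (hx : x ≠ 1) :
    μ.real {ω | Conn f (restr X ω) 1 x} = 0 := by
  have h0 : ∀ e, μ {ω | ω e = true} = 0 := fun e => by simpa using hμ {e} fun _ => true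
  rw [measureReal_def, measure_mono_null ?_ (measure_iUnion_null h0), ENNReal.toReal_zero]
  intro ω hω
  by_contra hcl
  simp only [Set.mem_iUnion, not_exists] at hcl
  exact hx (Conn.induction (P := (· = 1)) (Conn.of_restr hω) rfl
    fun a i ho => absurd ho (hcl (a, i)))

lemma finite_ballEdges [Finite ι] (n : ℕ) : (ballEdges f n).Finite := by
  refine ((finite_ball (Set.finite_range f) n).prod (Set.finite_univ (α := ι))).subset ?_
  exact fun e he => ⟨he.1, Set.mem_univ _⟩

lemma le_of_forall_lt_of_continuous {F : ℝ → ℝ} (hF : Continuous F) {q c : ℝ} (hq : 0 < q)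
    (h : ∀ p, 0 ≤ p → p < q → F p ≤ c) : F q ≤ c := by
  have hcl : IsClosed {p | F p ≤ c} := isClosed_le hF continuous_const
  have hsub : Set.Ico 0 q ⊆ {p | F p ≤ c} := fun p hp => h p hp.1 hp.2
  have := hcl.closure_subset_iff.2 hsub
  rw [closure_Ico hq.ne] at this
  exact this ⟨hq.le, le_rfl⟩

/-- The sum of the two-point function is not bounded below the critical probability, even up to
a power of the parameter. -/
theorem pc_eq_one_of_sum_conn_le [Countable G] [Finite ι] {μ : ℝ → Measure (Config (G × ι))}
    (hμ : ∀ p ∈ Set.Icc (0 : ℝ) 1, IsBernoulli p (μ p)) {L : ℕ}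
    (hsum : ∀ p, 0 ≤ p → p < pc f μ → ∀ B : Finset G, 1 ∉ B →
      (∑ g ∈ B, (μ p).real {ω | Conn f ω 1 g}) * p ^ L ≤ 1) : pc f μ = 1 := by
  classical
  obtain ⟨hq0, hq1⟩ := pc_mem_Icc f μ
  refine hq1.eq_or_lt.resolve_right fun hlt => ?_
  set q := pc f μ with hq
  have hfin : ∀ m, (ball (Set.range f) (m + 1) \ ball (Set.range f) m).Finite := fun m =>
    (finite_ball (Set.finite_range f) (m + 1)).subset Set.sdiff_subset
  choose h hcont hh using fun (m : ℕ) (x : G) => exists_continuous_real_eq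
    (s := {ω | Conn f (restr (ballEdges f (m + 1)) ω) 1 x}) (finite_ballEdges (m + 1))
    (determinedBy_setOf_restr (fun ω => Conn f ω 1 x) _)
  let Φ : ℕ → ℝ → ℝ := fun m p => ∑ x ∈ (hfin m).toFinset, h m x p
  have hΦc : ∀ m, Continuous (Φ m) := fun m => continuous_finsetSum _ fun x _ => hcont m x
  obtain ⟨m, hm⟩ : ∃ m, Φ m q < 1 := by
    obtain hq0 | hq0 := hq0.eq_or_lt
    · refine ⟨0, ?_⟩
      have : Φ 0 q = 0 := Finset.sum_eq_zero fun x hx => by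
        have h0 := hμ 0 ⟨le_rfl, zero_le_one⟩
        rw [← hq0, ← hh 0 x 0 ⟨le_rfl, zero_le_one⟩ _ h0]
        refine real_conn_restr_eq_zero h0 _ ?_
        rintro rfl
        exact ((hfin 0).mem_toFinset.1 hx).2 (one_mem_ball _ _)
      rw [this]
      exact one_pos
    · by_contra! hge
      have hle : ∀ N : ℕ, (N : ℝ) * q ^ L ≤ 1 := fun N => by
        have h1 : (∑ m ∈ Finset.range N, Φ m q) * q ^ L ≤ 1 := by
          refine le_of_forall_lt_of_continuous
            (F := fun p => (∑ m ∈ Finset.range N, Φ m p) * p ^ L)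
            ((continuous_finsetSum _ fun m _ => hΦc m).mul (continuous_pow L)) hq0
            fun p hp0 hpq => ?_
          have hp : p ∈ Set.Icc (0 : ℝ) 1 := ⟨hp0, hpq.le.trans hq1⟩
          have := (hμ p hp).isProbabilityMeasure
          have hdisj : Set.PairwiseDisjoint (Finset.range N : Set ℕ)
              (fun m => (hfin m).toFinset) := by
            have aux : ∀ k l, k < l → Disjoint (hfin k).toFinset (hfin l).toFinset :=
              fun k l hkl => Finset.disjoint_left.2 fun x hk hl =>
                ((hfin l).mem_toFinset.1 hl).2 (ball_mono hkl ((hfin k).mem_toFinset.1 hk).1)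
            intro k _ l _ hkl
            obtain hkl | hkl := hkl.lt_or_gt
            exacts [aux k l hkl, (aux l k hkl).symm]
          refine le_trans ?_ (hsum p hp0 hpq
            ((Finset.range N).biUnion fun m => (hfin m).toFinset) ?_)
          · refine mul_le_mul_of_nonneg_right ?_ (pow_nonneg hp0 L)
            rw [Finset.sum_biUnion hdisj]
            refine Finset.sum_le_sum fun m _ => Finset.sum_le_sum fun x _ => ?_
            rw [← hh m x p hp _ (hμ p hp)]
            exact measureReal_mono (fun ω hω => Conn.of_restr hω) (measure_ne_top _ _)
          · simp only [Finset.mem_biUnion, not_exists, not_and]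
            exact fun m _ hx => ((hfin m).mem_toFinset.1 hx).2 (one_mem_ball _ _)
        refine le_trans (mul_le_mul_of_nonneg_right ?_ (pow_nonneg hq0.le L)) h1
        simpa using Finset.card_nsmul_le_sum (Finset.range N) (fun m => Φ m q) 1
          fun m _ => hge m
      obtain ⟨N, hN⟩ := exists_nat_gt (1 / q ^ L)
      exact (hle N).not_gt ((div_lt_iff₀ (pow_pos hq0 L)).1 hN)
  obtain ⟨r, hqr, hr⟩ : ∃ r > q, ∀ p, q ≤ p → p < r → Φ m p < 1 := by
    obtain ⟨ε, hε, hball⟩ := Metric.isOpen_iff.1 (isOpen_lt (hΦc m) continuous_const) q hm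
    refine ⟨q + ε, by linarith, fun p hp hpr => hball ?_⟩
    rw [Metric.mem_ball, Real.dist_eq, abs_of_nonneg (by linarith)]
    linarith
  obtain ⟨p, hp, hqp, hpr, hpos⟩ := exists_theta_pos_of_pc_lt hlt hqr
  refine hpos.ne' (theta_eq_zero_of_sum_lt_one (n := m) hp (hμ p hp) (hfin m).toFinset
    (by rw [Set.Finite.coe_toFinset]) ?_)
  simp only [hh m _ p hp _ (hμ p hp)]
  exact hr p hqp hpr

end CriticalProbability

lemma exists_two_le_card_mul_card {n : ℕ} (hn : 2 ≤ n) {G : Fin n → Type*} [∀ i, Group (G i)]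
    [∀ i, Nontrivial (G i)] (hnotZ : ¬ (n = 2 ∧ ∀ i, Nat.card (G i) = 2)) :
    ∃ (i₀ : Fin n) (B : Finset (G i₀)) (B' : Finset (Σ j, G j)), 1 ∉ B ∧
      (∀ s ∈ B', s.1 ≠ i₀ ∧ s.2 ≠ 1) ∧ 2 ≤ B.card * B'.card := by
  classical
  have hne : ∀ i, ∃ g : G i, g ≠ 1 := fun i => exists_ne 1
  choose g hg using hne
  obtain rfl | hn := hn.eq_or_lt
  · obtain ⟨i, hi⟩ : ∃ i, Nat.card (G i) ≠ 2 := by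
      by_contra! h
      exact hnotZ ⟨rfl, h⟩
    obtain ⟨j, hj⟩ := exists_ne i
    obtain ⟨x, hx1, hxg⟩ : ∃ x : G i, x ≠ 1 ∧ x ≠ g i := by
      by_contra! h
      exact hi ((Nat.card_eq_two_iff' 1).2 ⟨g i, hg i, h⟩)
    refine ⟨i, {x, g i}, {⟨j, g j⟩}, ?_, ?_, ?_⟩
    · simp [hx1.symm, (hg i).symm]
    · simp [hj, hg]
    · simp [hxg]
  · refine ⟨⟨0, by omega⟩, {g _}, {⟨⟨1, by omega⟩, g _⟩, ⟨⟨2, by omega⟩, g _⟩}, ?_, ?_, ?_⟩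
    · simp [(hg _).symm]
    · simp [hg]
    · rw [Finset.card_pair (by simp)]
      simp

end Perc

/-- For `n ≥ 2` nontrivial finitely generated groups `Gᵢ` with finite
generating sets `Sᵢ`, if the free product is not virtually `ℤ` (i.e. it is not the case
that `n = 2` and all factors have exactly two elements), then
`p_c(G₁ * ⋯ * G_n) < min_i p_c(Gᵢ)`. -/
theorem pc_free_product_lt_min
    {n : ℕ} (hn : 2 ≤ n) {G : Fin n → Type*} [∀ i, Group (G i)] [∀ i, Nontrivial (G i)]
    (S : ∀ i, Set (G i)) (hfin : ∀ i, (S i).Finite)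
    (hgen : ∀ i, Subgroup.closure (S i) = ⊤)
    (hnotZ : ¬ (n = 2 ∧ ∀ i, Nat.card (G i) = 2))
    (μi : ∀ i, ℝ → Measure (Config (G i × S i)))
    (μ : ℝ → Measure (Config (Monoid.CoprodI G × (Σ i, S i))))
    (hμi : ∀ i, ∀ p ∈ Set.Icc (0 : ℝ) 1, IsBernoulli p (μi i p))
    (hμ : ∀ p ∈ Set.Icc (0 : ℝ) 1, IsBernoulli p (μ p)) :
    pc (coprodIGens S) μ < ⨅ i : Fin n, pc (setGens (S i)) (μi i) := by
  have : Nontrivial (Fin n) := Fin.nontrivial_iff_two_le.2 hn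
  have hcount : ∀ i, Countable (G i) := fun i => countable_of_closure_eq_top (hfin i) (hgen i)
  have hfinS : ∀ i, Finite (S i) := fun i => (hfin i).to_subtype
  by_contra! hle
  have hsum : ∀ p, 0 ≤ p → p < (⨅ i : Fin n, pc (setGens (S i)) (μi i)) →
      ∀ (i₀ : Fin n) (B : Finset (G i₀)) (B' : Finset (Σ j, G j)), 1 ∉ B →
      (∀ s ∈ B', s.1 ≠ i₀ ∧ s.2 ≠ 1) →
      (∑ g ∈ B, (μi i₀ p).real {ω | Conn (setGens (S i₀)) ω 1 g}) *
        (∑ s ∈ B', (μi s.1 p).real {ω | Conn (setGens (S s.1)) ω 1 s.2}) ≤ 1 := by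
    intro p hp0 hpq i₀ B B' hB hB'
    have hp : p ∈ Set.Icc (0 : ℝ) 1 := ⟨hp0, (hpq.trans_le hle).le.trans (pc_mem_Icc _ _).2⟩
    by_contra! h
    exact (theta_coprodI_pos hp (fun i => hμi i p hp) (hμ p hp) hB hB' h).ne'
      (theta_eq_zero_of_lt_pc hp (hpq.trans_le hle))
  obtain ⟨i₀, hi₀⟩ := exists_eq_ciInf_of_finite (f := fun i => pc (setGens (S i)) (μi i))
  have hq1 : pc (setGens (S i₀)) (μi i₀) = 1 := by
    obtain ⟨j, hj⟩ := exists_ne i₀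
    obtain ⟨g, hg⟩ := exists_ne (1 : G j)
    obtain ⟨L, hL⟩ := exists_pow_le_real_conn (hgen j) g
    refine pc_eq_one_of_sum_conn_le (hμi i₀) (L := L) fun p hp0 hpq B hB => ?_
    have hp : p ∈ Set.Icc (0 : ℝ) 1 := ⟨hp0, hpq.le.trans (pc_mem_Icc _ _).2⟩
    have h1 := hsum p hp0 (hi₀ ▸ hpq) i₀ B {⟨j, g⟩} hB (by simp [hj, hg])
    rw [Finset.sum_singleton] at h1
    refine le_trans (mul_le_mul_of_nonneg_left (hL p hp _ (hμi j p hp)) ?_) h1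
    exact Finset.sum_nonneg fun _ _ => measureReal_nonneg
  obtain ⟨i, B, B', hB, hB', hcard⟩ := exists_two_le_card_mul_card hn hnotZ
  choose L hL using fun j => exists_pow_le_real_conn (hgen j)
  have h1 := le_of_forall_lt_of_continuous (q := 1) (c := 1)
    (F := fun p : ℝ => (∑ g ∈ B, p ^ L i g) * ∑ s ∈ B', p ^ L s.1 s.2) (by fun_prop) one_pos
    fun p hp0 hp1 => by
      have hp : p ∈ Set.Icc (0 : ℝ) 1 := ⟨hp0, hp1.le⟩
      refine le_trans (mul_le_mul ?_ ?_ ?_ ?_) (hsum p hp0 (by rwa [← hi₀, hq1]) i B B' hB hB')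
      · exact Finset.sum_le_sum fun g _ => hL i g p hp _ (hμi i p hp)
      · exact Finset.sum_le_sum fun s _ => hL s.1 s.2 p hp _ (hμi s.1 p hp)
      · exact Finset.sum_nonneg fun _ _ => pow_nonneg hp0 _
      · exact Finset.sum_nonneg fun _ _ => measureReal_nonneg
  have h2 : (2 : ℝ) ≤ B.card * B'.card := by exact_mod_cast hcard
  simp only [one_pow, Finset.sum_const, nsmul_eq_mul, mul_one] at h1
  linarith
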